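/- arXiv:2501.06649 — 6 statements merged into one kernel-verified Lean document; each statement's English description precedes it below -/
import Mathlib

section
/- Let Σ be a complete fan in ℝ^n. Then every cone τ ∈ Σ is the intersection of all top-dimensional cones of Σ containing it: τ = ⋂ {σ ∈ Σ : σ spans ℝ^n and τ ⊆ σ}. In particular, the composite l ∘ r of the maps r(τ) := {σ ∈ Σ top-dimensional : τ ⊆ σ} and l(S) := ⋂_{σ ∈ S} σ is the identity on Σ. -/
open scoped RealInnerProductSpace

noncomputable section

/-- The dual cone of a subset `C` of ℝⁿ. -/
def dualCone {n : ℕ} (C : Set (EuclideanSpace ℝ (Fin n))) :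
    Set (EuclideanSpace ℝ (Fin n)) :=
  {u | ∀ v ∈ C, 0 ≤ ⟪u, v⟫}

/-- A subset of ℝⁿ is a finitely generated (polyhedral) convex cone if it is the set of
all nonnegative linear combinations of a finite set of vectors. -/
def IsFGCone {n : ℕ} (σ : Set (EuclideanSpace ℝ (Fin n))) : Prop :=
  ∃ s : Finset (EuclideanSpace ℝ (Fin n)),
    σ = {x | ∃ c : EuclideanSpace ℝ (Fin n) → ℝ, (∀ v, 0 ≤ c v) ∧ x = ∑ v ∈ s, c v • v}

/-- A cone is pointed if `C ∩ (−C) = {0}`. -/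
def IsPointed {n : ℕ} (C : Set (EuclideanSpace ℝ (Fin n))) : Prop :=
  C ∩ (-C) = {0}

/-- `F` is a face of the cone `C` if `F = C ∩ u^⊥` for some `u ∈ C^∨`. -/
def IsFaceOf {n : ℕ} (F C : Set (EuclideanSpace ℝ (Fin n))) : Prop :=
  ∃ u ∈ dualCone C, F = C ∩ {v | ⟪u, v⟫ = 0}

/-- A fan in ℝⁿ: a finite set of pointed finitely generated convex cones, closed under
taking faces, such that the intersection of any two cones is a face of each of them. -/
structure IsFan {n : ℕ} (S : Set (Set (EuclideanSpace ℝ (Fin n)))) : Prop where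
  finite : S.Finite
  fg : ∀ σ ∈ S, IsFGCone σ
  pointed : ∀ σ ∈ S, IsPointed σ
  face_mem : ∀ σ ∈ S, ∀ F, IsFaceOf F σ → F ∈ S
  inter_face : ∀ σ ∈ S, ∀ τ ∈ S, IsFaceOf (σ ∩ τ) σ ∧ IsFaceOf (σ ∩ τ) τ

namespace IsFGCone

variable {n : ℕ} {C : Set (EuclideanSpace ℝ (Fin n))}

lemma zero_mem (hC : IsFGCone C) : (0 : EuclideanSpace ℝ (Fin n)) ∈ C := by
  obtain ⟨s, rfl⟩ := hC
  exact ⟨0, fun _ => le_rfl, by simp⟩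

lemma add_mem (hC : IsFGCone C) {x y : EuclideanSpace ℝ (Fin n)} (hx : x ∈ C) (hy : y ∈ C) :
    x + y ∈ C := by
  obtain ⟨s, rfl⟩ := hC
  obtain ⟨c, hc, rfl⟩ := hx
  obtain ⟨d, hd, rfl⟩ := hy
  exact ⟨c + d, fun v => add_nonneg (hc v) (hd v), by simp [add_smul, Finset.sum_add_distrib]⟩

lemma smul_mem (hC : IsFGCone C) {t : ℝ} (ht : 0 ≤ t) {x : EuclideanSpace ℝ (Fin n)}
    (hx : x ∈ C) : t • x ∈ C := by
  obtain ⟨s, rfl⟩ := hC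
  obtain ⟨c, hc, rfl⟩ := hx
  exact ⟨t • c, fun v => mul_nonneg ht (hc v), by simp [Finset.smul_sum, smul_smul]⟩

/-- A finitely generated cone contains a point such that every linear functional that is
nonnegative on the cone and vanishes at this point vanishes on the whole cone. -/
lemma exists_relInterior_point (hC : IsFGCone C) :
    ∃ p ∈ C, ∀ u ∈ dualCone C, ⟪u, p⟫ = 0 → ∀ x ∈ C, ⟪u, x⟫ = 0 := by
  classical
  obtain ⟨s, rfl⟩ := hC
  refine ⟨∑ v ∈ s, v, ⟨1, fun _ => zero_le_one, by simp⟩, fun u hu hp => ?_⟩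
  have hmem : ∀ v ∈ s, 0 ≤ ⟪u, v⟫ := fun v hv =>
    hu v ⟨Pi.single v 1, fun w => by by_cases h : w = v <;> simp [h],
      by simp [Pi.single_apply, ite_smul, hv]⟩
  rw [inner_sum, Finset.sum_eq_zero_iff_of_nonneg hmem] at hp
  rintro x ⟨c, -, rfl⟩
  rw [inner_sum]
  exact Finset.sum_eq_zero fun v hv => by rw [inner_smul_right, hp v hv, mul_zero]

/-- The nonzero vectors of a pointed finitely generated cone form a convex set. -/
lemma convex_diff_zero (hC : IsFGCone C) (hp : IsPointed C) : Convex ℝ (C \ {0}) := by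
  rw [convex_iff_forall_pos]
  rintro x ⟨hx, hx0⟩ y ⟨hy, -⟩ a b ha hb -
  have hax := hC.smul_mem ha.le hx
  have hby := hC.smul_mem hb.le hy
  refine ⟨hC.add_mem hax hby, fun h => hx0 ?_⟩
  have hneg : a • x ∈ C ∩ (-C) := ⟨hax, by
    rwa [Set.mem_neg, neg_eq_of_add_eq_zero_right h]⟩
  rw [hp] at hneg
  exact (smul_eq_zero.1 hneg).resolve_left ha.ne'

/-- A pointed finitely generated cone is closed. -/
lemma isClosed (hC : IsFGCone C) (hp : IsPointed C) : IsClosed C := by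
  classical
  obtain ⟨s, hs⟩ := id hC
  set s' : Finset (EuclideanSpace ℝ (Fin n)) := s.filter (· ≠ 0) with hs'
  set K := convexHull ℝ (s' : Set (EuclideanSpace ℝ (Fin n)))
  have hKC : K ⊆ C \ {0} := by
    refine convexHull_min (fun v hv => ?_) (hC.convex_diff_zero hp)
    rw [Finset.mem_coe, hs', Finset.mem_filter] at hv
    refine ⟨?_, hv.2⟩
    rw [hs]
    exact ⟨Pi.single v 1, fun w => by by_cases h : w = v <;> simp [h],
      by simp [Pi.single_apply, ite_smul, hv.1]⟩
  have hKcomp : IsCompact K := s'.finite_toSet.isCompact_convexHull ℝ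
  have hCeq : C = {0} ∪ Prod.fst '' {z : EuclideanSpace ℝ (Fin n) × K |
      ‖(z.2 : EuclideanSpace ℝ (Fin n))‖ • z.1 = ‖z.1‖ • (z.2 : EuclideanSpace ℝ (Fin n))} := by
    ext x
    constructor
    · intro hx
      rw [hs] at hx
      obtain ⟨c, hc, hxc⟩ := hx
      by_cases hx0 : x = 0
      · exact Or.inl hx0
      have hxs' : x = ∑ v ∈ s', c v • v := by
        rw [hxc, hs', Finset.sum_filter]
        exact Finset.sum_congr rfl fun v _ => by by_cases h : v = 0 <;> simp [h]
      have hpos : 0 < ∑ v ∈ s', c v := by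
        refine (Finset.sum_nonneg fun v _ => hc v).lt_of_ne fun h => hx0 ?_
        rw [hxs']
        refine Finset.sum_eq_zero fun v hv => ?_
        rw [(Finset.sum_eq_zero_iff_of_nonneg fun v _ => hc v).1 h.symm v hv, zero_smul]
      have hmem : (∑ v ∈ s', c v)⁻¹ • x ∈ K := by
        have := s'.centerMass_mem_convexHull (fun v _ => hc v) hpos
          (z := id) (fun v hv => Finset.mem_coe.2 hv)
        simpa only [Finset.centerMass, id_eq, ← hxs'] using this
      refine Or.inr ⟨(x, ⟨_, hmem⟩), ?_, rfl⟩
      simp only [Set.mem_ofPred_eq]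
      rw [norm_smul, Real.norm_of_nonneg (inv_nonneg.2 hpos.le), smul_smul, mul_comm]
    · rintro (rfl | ⟨⟨x, k⟩, h, rfl⟩)
      · exact hC.zero_mem
      · have hk := hKC k.2
        have hk0 : ‖(k : EuclideanSpace ℝ (Fin n))‖ ≠ 0 := norm_ne_zero_iff.2 hk.2
        have hx : x = (‖(k : EuclideanSpace ℝ (Fin n))‖⁻¹ * ‖x‖) •
            (k : EuclideanSpace ℝ (Fin n)) := by
          rw [mul_smul, ← h, smul_smul, inv_mul_cancel₀ hk0, one_smul]
        change x ∈ C
        rw [hx]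
        exact hC.smul_mem (by positivity) hk.1
  have : CompactSpace K := isCompact_iff_compactSpace.1 hKcomp
  rw [hCeq]
  exact isClosed_singleton.union
    (isClosedMap_fst_of_compactSpace _ (isClosed_eq (by fun_prop) (by fun_prop)))

end IsFGCone

/-- The top-dimensional members of a finite closed cover of ℝⁿ already cover ℝⁿ. -/
lemma exists_mem_span_eq_top {n : ℕ} {S : Set (Set (EuclideanSpace ℝ (Fin n)))}
    (hfin : S.Finite) (hclosed : ∀ σ ∈ S, IsClosed σ) (hcover : ⋃₀ S = Set.univ)
    (x : EuclideanSpace ℝ (Fin n)) : ∃ σ ∈ S, Submodule.span ℝ σ = ⊤ ∧ x ∈ σ := by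
  set T := {σ ∈ S | Submodule.span ℝ σ = ⊤}
  set N := {σ ∈ S | Submodule.span ℝ σ ≠ ⊤}
  have hT : IsClosed (⋃₀ T) := by
    rw [Set.sUnion_eq_biUnion]
    exact (hfin.subset (Set.sep_subset _ _)).isClosed_biUnion fun σ hσ => hclosed σ hσ.1
  have hN : MeasureTheory.volume (⋃₀ N) = 0 := by
    rw [MeasureTheory.measure_sUnion_null_iff (hfin.subset (Set.sep_subset _ _)).countable]
    exact fun σ hσ => MeasureTheory.measure_mono_null Submodule.subset_span
      (MeasureTheory.Measure.addHaar_submodule _ _ hσ.2)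
  have hsub : (⋃₀ T)ᶜ ⊆ ⋃₀ N := by
    intro y hy
    obtain ⟨σ, hσ, hyσ⟩ : y ∈ ⋃₀ S := hcover ▸ Set.mem_univ y
    exact ⟨σ, ⟨hσ, fun h => hy ⟨σ, ⟨hσ, h⟩, hyσ⟩⟩, hyσ⟩
  have hempty := hT.isOpen_compl.measure_eq_zero_iff MeasureTheory.volume |>.1
    (MeasureTheory.measure_mono_null hsub hN)
  obtain ⟨σ, hσ, hxσ⟩ : x ∈ ⋃₀ T := Set.compl_empty_iff.1 hempty ▸ Set.mem_univ x
  exact ⟨σ, hσ.1, hσ.2, hxσ⟩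

/-- In a complete fan, every cone `τ` is the intersection of all top-dimensional cones
(cones spanning ℝⁿ) of the fan that contain it. -/
theorem cone_eq_sInter_topDimensional {n : ℕ}
    (S : Set (Set (EuclideanSpace ℝ (Fin n)))) (hS : IsFan S)
    (hcomplete : ⋃₀ S = Set.univ)
    {τ : Set (EuclideanSpace ℝ (Fin n))} (hτ : τ ∈ S) :
    τ = ⋂₀ {σ | σ ∈ S ∧ Submodule.span ℝ σ = ⊤ ∧ τ ⊆ σ} := by
  refine Set.Subset.antisymm (Set.subset_sInter fun σ hσ => hσ.2.2) fun x hx => ?_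
  have hclosed : ∀ σ ∈ S, IsClosed σ := fun σ hσ => (hS.fg σ hσ).isClosed (hS.pointed σ hσ)
  obtain ⟨p, hpτ, hp⟩ := (hS.fg τ hτ).exists_relInterior_point
  have hF : IsClosed (⋃₀ {σ ∈ S | p ∉ σ}) := by
    rw [Set.sUnion_eq_biUnion]
    exact (hS.finite.subset (Set.sep_subset _ _)).isClosed_biUnion fun σ hσ => hclosed σ hσ.1
  have hnhds : ∀ᶠ t : ℝ in nhds 0, p - t • x ∈ (⋃₀ {σ ∈ S | p ∉ σ})ᶜ := by
    have hcont : Continuous fun t : ℝ => p - t • x := by fun_prop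
    refine hcont.continuousAt.eventually_mem (hF.isOpen_compl.mem_nhds ?_)
    rintro ⟨σ, hσ, hpσ⟩
    exact hσ.2 (by simpa using hpσ)
  obtain ⟨t, ht, ht0 : 0 < t⟩ :=
    ((hnhds.filter_mono nhdsWithin_le_nhds).and (self_mem_nhdsWithin (s := Set.Ioi 0))).exists
  obtain ⟨σ, hσ, hspan, htσ⟩ :=
    exists_mem_span_eq_top hS.finite hclosed hcomplete (p - t • x)
  have hpσ : p ∈ σ := by
    by_contra h
    exact ht ⟨σ, ⟨hσ, h⟩, htσ⟩
  obtain ⟨⟨u, hu, huσ⟩, ⟨w, hw, hwτ⟩⟩ := hS.inter_face σ hσ τ hτ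
  have hwp : p ∈ τ ∩ {v | ⟪w, v⟫ = 0} := hwτ ▸ ⟨hpσ, hpτ⟩
  have hτσ : τ ⊆ σ := fun y hy =>
    (hwτ.symm ▸ (⟨hy, hp w hw hwp.2 y hy⟩ : y ∈ τ ∩ {v | ⟪w, v⟫ = 0}) : y ∈ σ ∩ τ).1
  have hxσ : x ∈ σ := hx σ ⟨hσ, hspan, hτσ⟩
  have hup : p ∈ σ ∩ {v | ⟪u, v⟫ = 0} := huσ ▸ ⟨hpσ, hpτ⟩
  have hux : ⟪u, x⟫ = 0 := by
    refine le_antisymm ?_ (hu x hxσ)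
    have h := hu _ htσ
    rw [inner_sub_right, inner_smul_right, hup.2, zero_sub, neg_nonneg] at h
    exact nonpos_of_mul_nonpos_right h ht0
  exact (huσ.symm ▸ (⟨hxσ, hux⟩ : x ∈ σ ∩ {v | ⟪u, v⟫ = 0}) : x ∈ σ ∩ τ).2
end
end

section
/- Let P ⊆ ℝ^n be the convex hull of a finite set of points, with nonempty interior, and let m ∈ ℝ^n be nonzero. Then the set P_{m,−} := {p ∈ P : for all t > 0, p + t·m ∉ interior(P)} is nonempty, closed in P, and contractible as a topological space with the subspace topology. -/
noncomputable section

/-- The set of points of `P` "visible from infinity in the direction `m`": those `p ∈ P`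
whose open ray `p + ℝ_{>0}·m` never meets the interior of `P`. -/
def visibleSet {n : ℕ} (P : Set (EuclideanSpace ℝ (Fin n)))
    (m : EuclideanSpace ℝ (Fin n)) : Set (EuclideanSpace ℝ (Fin n)) :=
  {p | p ∈ P ∧ ∀ t : ℝ, 0 < t → p + t • m ∉ interior P}

open Set Topology in
/-- The part of the unit sublevel set of a continuous sublinear functional `g` that is visible from
infinity in the direction `m` contracts radially, along `g`-normalized segments towards `m`. -/
theorem contractibleSpace_visible_of_sublinear {E : Type*} [AddCommGroup E] [Module ℝ E]
    [TopologicalSpace E] [IsTopologicalAddGroup E] [ContinuousSMul ℝ E] {g : E → ℝ} {m : E}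
    (hg : Continuous g) (hadd : ∀ x y, g (x + y) ≤ g x + g y)
    (hsmul : ∀ (c : ℝ) (x : E), 0 ≤ c → g (c • x) = c * g x) (hm : 0 < g m) :
    ContractibleSpace {p : E | g p ≤ 1 ∧ ∀ t : ℝ, 0 < t → 1 ≤ g (p + t • m)} := by
  set V : Set E := {p : E | g p ≤ 1 ∧ ∀ t : ℝ, 0 < t → 1 ≤ g (p + t • m)} with hV
  have hline : ∀ p ∈ V, ∀ t : ℝ, 0 ≤ t → 1 ≤ g (p + t • m) := by
    intro p hp t ht
    have hcl : IsClosed {t : ℝ | 1 ≤ g (p + t • m)} :=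
      isClosed_le continuous_const (hg.comp (by fun_prop))
    have hsub : closure (Ioi (0 : ℝ)) ⊆ {t : ℝ | 1 ≤ g (p + t • m)} :=
      closure_minimal (fun t ht => hp.2 t ht) hcl
    rw [closure_Ioi] at hsub
    exact hsub ht
  have hone : ∀ p ∈ V, g p = 1 := fun p hp =>
    le_antisymm hp.1 (by simpa using hline p hp 0 le_rfl)
  have hle : ∀ p ∈ V, ∀ s : ℝ, 0 ≤ s → s ≤ 1 → 1 - s ≤ g ((1 - s) • p + s • m) := by
    intro p hp s hs0 hs1
    rcases hs1.eq_or_lt with rfl | hs1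
    · simpa using hm.le
    · have h1 : 0 < 1 - s := sub_pos.2 hs1
      have h2 : (1 - s) • p + s • m = (1 - s) • (p + (s / (1 - s)) • m) := by
        rw [smul_add, smul_smul, mul_div_cancel₀ _ h1.ne']
      rw [h2, hsmul _ _ h1.le]
      exact le_mul_of_one_le_right h1.le (hline p hp _ (div_nonneg hs0 h1.le))
  have hpos : ∀ p ∈ V, ∀ s : ℝ, 0 ≤ s → s ≤ 1 → 0 < g ((1 - s) • p + s • m) := by
    intro p hp s hs0 hs1
    rcases hs1.eq_or_lt with rfl | hs1
    · simpa using hm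
    · exact (sub_pos.2 hs1).trans_le (hle p hp s hs0 hs1.le)
  have hmem : ∀ p ∈ V, ∀ s : ℝ, 0 ≤ s → s ≤ 1 →
      (g ((1 - s) • p + s • m))⁻¹ • ((1 - s) • p + s • m) ∈ V := by
    intro p hp s hs0 hs1
    rcases hs0.eq_or_lt with rfl | hs0
    · simpa [hone p hp] using hp
    have hr := hpos p hp s hs0.le hs1
    have hlr := hle p hp s hs0.le hs1
    set r := (1 - s) • p + s • m with hrdef
    have hq : g ((g r)⁻¹ • r) = 1 := by
      rw [hsmul _ _ (inv_nonneg.2 hr.le), inv_mul_cancel₀ hr.ne']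
    refine ⟨hq.le, fun t ht => ?_⟩
    by_contra! hlt
    -- `q = r / g r` is a convex combination of `q + t • m` and of a point of `g`-value at most `1`.
    have hb : 0 < s / g r := div_pos hs0 hr
    set β := (s / g r) / (s / g r + t) with hβ
    have hβ0 : 0 < β := by positivity
    have hβ1 : β ≤ 1 := by
      rw [hβ, div_le_one (by positivity)]
      linarith
    have hβt : β * (s / g r + t) = s / g r := div_mul_cancel₀ _ (by positivity)
    have hcomb : (g r)⁻¹ • r =
        ((1 - β) * ((1 - s) / g r)) • p + β • ((g r)⁻¹ • r + t • m) := by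
      have h1 : (g r)⁻¹ • r = ((1 - s) / g r) • p + (s / g r) • m := by
        rw [hrdef, smul_add, smul_smul, smul_smul, ← hrdef, inv_mul_eq_div, inv_mul_eq_div]
      rw [h1]
      nth_rewrite 1 [← hβt]
      module
    have hc : 0 ≤ (1 - s) / g r := div_nonneg (sub_nonneg.2 hs1) hr.le
    have hc1 : (1 - s) / g r ≤ 1 := (div_le_one hr).2 hlr
    have h1 := hadd (((1 - β) * ((1 - s) / g r)) • p) (β • ((g r)⁻¹ • r + t • m))
    rw [← hcomb, hq, hsmul _ _ (mul_nonneg (sub_nonneg.2 hβ1) hc), hsmul _ _ hβ0.le, hone p hp,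
      mul_one] at h1
    have h2 := mul_lt_mul_of_pos_left hlt hβ0
    have h3 := mul_le_of_le_one_right (sub_nonneg.2 hβ1) hc1
    linarith
  have htop : (g m)⁻¹ • m ∈ V := by
    refine ⟨?_, fun t ht => ?_⟩
    · rw [hsmul _ _ (inv_nonneg.2 hm.le), inv_mul_cancel₀ hm.ne']
    · rw [← add_smul, hsmul _ _ (by positivity), add_mul, inv_mul_cancel₀ hm.ne']
      have := mul_pos ht hm
      linarith
  rw [contractible_iff_id_nullhomotopic]
  refine ⟨⟨_, htop⟩, ⟨⟨⟨fun x => ⟨_, hmem x.2 x.2.2 x.1 x.1.2.1 x.1.2.2⟩, ?_⟩, ?_, ?_⟩⟩⟩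
  · refine Continuous.subtype_mk ?_ _
    have hr : Continuous fun x : unitInterval × V =>
        (1 - (x.1 : ℝ)) • (x.2 : E) + (x.1 : ℝ) • m := by fun_prop
    exact ((hg.comp hr).inv₀ fun x => (hpos x.2 x.2.2 x.1 x.1.2.1 x.1.2.2).ne').smul hr
  · intro p
    ext
    simp [hone p p.2]
  · intro p
    ext
    simp

open Set Topology in
/-- The part of a bounded closed convex body visible from infinity is contractible. -/
theorem Convex.contractibleSpace_visible {E : Type*} [NormedAddCommGroup E] [NormedSpace ℝ E]
    {P : Set E} (hc : Convex ℝ P) (hcl : IsClosed P) (hb : Bornology.IsBounded P)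
    (hint : (interior P).Nonempty) {m : E} (hm : m ≠ 0) :
    ContractibleSpace {p : E | p ∈ P ∧ ∀ t : ℝ, 0 < t → p + t • m ∉ interior P} := by
  obtain ⟨c, hc0⟩ := hint
  set Q : Set E := (Homeomorph.addLeft c) ⁻¹' P with hQ
  have hQc : Convex ℝ Q := hc.translate_preimage_right c
  have hQ0 : Q ∈ 𝓝 (0 : E) := by
    refine (Homeomorph.addLeft c).continuous.continuousAt.preimage_mem_nhds ?_
    simpa using mem_interior_iff_mem_nhds.1 hc0
  have hQcl : IsClosed Q := hcl.preimage (Homeomorph.addLeft c).continuous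
  have hQb : Bornology.IsVonNBounded ℝ Q := by
    rw [NormedSpace.isVonNBounded_iff]
    have : Q = (fun x => -c + x) '' P := by
      ext x
      simp [hQ]
    rw [this]
    exact (IsometryEquiv.addLeft (-c)).isometry.lipschitz.isBounded_image hb
  have hQabs : Absorbent ℝ Q := absorbent_nhds_zero hQ0
  have hvis := contractibleSpace_visible_of_sublinear (g := gauge Q) (m := m)
    (continuous_gauge hQc hQ0) (gauge_add_le hQc hQabs)
    (fun r x hr => by rw [gauge_smul_of_nonneg hr, smul_eq_mul]) ((gauge_pos hQabs hQb).2 hm)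
  refine @Homeomorph.contractibleSpace _ _ _ _ hvis
    (((Homeomorph.addLeft c).subtype fun x => ?_).symm)
  have h1 : gauge Q x ≤ 1 ↔ c + x ∈ P := by
    rw [gauge_le_one_iff_mem_closure hQc hQ0, hQcl.closure_eq]
    rfl
  have h2 : ∀ y, 1 ≤ gauge Q y ↔ c + y ∉ interior P := by
    intro y
    rw [← not_lt, gauge_lt_one_iff_mem_interior hQc hQ0, hQ,
      ← (Homeomorph.addLeft c).preimage_interior]
    rfl
  simp only [mem_ofPred_eq, h1, h2, Homeomorph.coe_addLeft, add_assoc]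

/-- For a polytope `P ⊆ ℝⁿ` (convex hull of a finite set) with nonempty interior and a
nonzero direction `m`, the set `P_{m,−}` of points of `P` visible from infinity in the
direction `m` is nonempty, closed in `P`, and contractible in the subspace topology. -/
theorem visibleSet_nonempty_closed_contractible {n : ℕ}
    (s : Finset (EuclideanSpace ℝ (Fin n))) (P : Set (EuclideanSpace ℝ (Fin n)))
    (hP : P = convexHull ℝ (s : Set (EuclideanSpace ℝ (Fin n))))
    (hint : (interior P).Nonempty)
    (m : EuclideanSpace ℝ (Fin n)) (hm : m ≠ 0) :
    (visibleSet P m).Nonempty ∧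
      IsClosed {x : P | (x : EuclideanSpace ℝ (Fin n)) ∈ visibleSet P m} ∧
      ContractibleSpace (visibleSet P m) := by
  have hclosed : IsClosed P := hP ▸ s.finite_toSet.isClosed_convexHull ℝ
  have hcontr : ContractibleSpace (visibleSet P m) :=
    (hP ▸ convex_convexHull ℝ _ : Convex ℝ P).contractibleSpace_visible hclosed
      (hP ▸ (s.finite_toSet.isCompact_convexHull ℝ).isBounded) hint hm
  refine ⟨Set.nonempty_coe_sort.1 inferInstance, ?_, hcontr⟩
  have hray : IsClosed {p | ∀ t : ℝ, 0 < t → p + t • m ∉ interior P} := by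
    simp only [Set.ofPred_forall]
    exact isClosed_iInter fun t => isClosed_iInter fun _ =>
      (isOpen_interior.preimage (continuous_add_const (t • m))).isClosed_compl
  exact (hclosed.inter hray).preimage continuous_subtype_val
end
end

section
/- Let P ⊆ ℝ^n be a compact convex set with nonempty interior, let m ∈ ℝ^n, let F ⊆ P be a convex subset, and let c be a point of the intrinsic (relative) interior of F. If c + t·m ∉ interior(P) for all t > 0, then for every c′ ∈ F one also has c′ + t·m ∉ interior(P) for all t > 0. -/
noncomputable section

open AffineMap in
/-- A segment from a point of `s` to a point of the intrinsic interior of `s` can be prolonged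
inside `s`. -/
theorem exists_pos_lineMap_neg_mem_of_mem_intrinsicInterior {E : Type*}
    [AddCommGroup E] [Module ℝ E] [TopologicalSpace E] [IsTopologicalAddGroup E]
    [ContinuousSMul ℝ E] {s : Set E} {x y : E}
    (hx : x ∈ intrinsicInterior ℝ s) (hy : y ∈ s) :
    ∃ r : ℝ, 0 < r ∧ lineMap x y (-r) ∈ s := by
  obtain ⟨z, hz, rfl⟩ := mem_intrinsicInterior.1 hx
  let g : ℝ → affineSpan ℝ s := fun r =>
    ⟨lineMap (z : E) y (-r), lineMap_mem _ z.2 (subset_affineSpan ℝ s hy)⟩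
  have hg : Continuous g := by
    refine Continuous.subtype_mk ?_ _
    simp only [lineMap_apply_module']
    fun_prop
  have hg0 : g 0 = z := Subtype.ext (by simp [g])
  have hnear : ∀ᶠ r in nhds (0 : ℝ), (g r : E) ∈ s :=
    hg.continuousAt.eventually_mem (s := Subtype.val ⁻¹' s) (hg0.symm ▸ mem_interior_iff_mem_nhds.1 hz)
  obtain ⟨r, hr, hrpos⟩ := ((hnear.filter_mono nhdsWithin_le_nhds).and
    (self_mem_nhdsWithin : Set.Ioi (0 : ℝ) ∈ nhdsWithin 0 (Set.Ioi 0))).exists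
  exact ⟨r, hrpos, hr⟩

/-- Let `P ⊆ ℝⁿ` be a compact convex set with nonempty interior, `F ⊆ P` convex, and
`c` a point of the intrinsic (relative) interior of `F`. If the open ray from `c` in
direction `m` misses the interior of `P`, then so does the open ray from every point
of `F`. -/
theorem ray_misses_interior_of_relativeInterior {n : ℕ}
    {P F : Set (EuclideanSpace ℝ (Fin n))}
    (hPcompact : IsCompact P) (hPconv : Convex ℝ P)
    (hPint : (interior P).Nonempty)
    (m : EuclideanSpace ℝ (Fin n))
    (hFP : F ⊆ P) (hFconv : Convex ℝ F)
    {c : EuclideanSpace ℝ (Fin n)} (hc : c ∈ intrinsicInterior ℝ F)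
    (h : ∀ t : ℝ, 0 < t → c + t • m ∉ interior P) :
    ∀ c' ∈ F, ∀ t : ℝ, 0 < t → c' + t • m ∉ interior P := by
  intro c' hc' t ht hmem
  obtain ⟨r, hr, hq⟩ := exists_pos_lineMap_neg_mem_of_mem_intrinsicInterior hc hc'
  refine h (r / (1 + r) * t) (by positivity) ?_
  have hcombo := hPconv.combo_interior_self_mem_interior hmem (hFP hq)
    (a := r / (1 + r)) (b := 1 / (1 + r)) (by positivity) (by positivity) (by field_simp; ring)
  convert hcombo using 1
  rw [AffineMap.lineMap_apply_module']
  match_scalars <;> field_simp <;> ring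
end
end

section
/- Let I be a finite index set, ν_η ∈ ℤ^n nonzero integer vectors and n_η ∈ ℝ for η ∈ I, and set P := {p ∈ ℝ^n : ⟨p, ν_η⟩ ≥ −n_η for all η ∈ I}. Assume P is nonempty, that for each η ∈ I there exists p ∈ P with ⟨p, ν_η⟩ = −n_η, and that no n_η is an integer. Let y ∈ P, let τ ⊆ ℝ^n be any subset, and let m ∈ ℤ^n satisfy ⟨y − m, w⟩ = 0 for all w ∈ τ. Then for every η ∈ I it is not the case that both ν_η ∈ τ and ⟨p − y, ν_η⟩ ≥ 0 for all p ∈ P. -/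
open scoped RealInnerProductSpace

noncomputable section

theorem EuclideanSpace.exists_int_inner_eq {ι : Type*} [Fintype ι] {v w : EuclideanSpace ℝ ι}
    (hv : ∀ i, ∃ z : ℤ, v i = z) (hw : ∀ i, ∃ z : ℤ, w i = z) : ∃ z : ℤ, ⟪v, w⟫ = (z : ℝ) := by
  choose a ha using hv
  choose b hb using hw
  exact ⟨∑ i, b i * a i, by simp [PiLp.inner_apply, ha, hb]⟩

/-- Let `P = {p ∈ ℝⁿ : ⟨p, ν_η⟩ ≥ −n_η for all η}` be a nonempty polyhedron cut out by
finitely many nonzero integer vectors `ν_η`, with each inequality attained on `P` and no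
`n_η` an integer. Let `y ∈ P`, `τ ⊆ ℝⁿ` any subset, and `m ∈ ℤⁿ` with `⟨y − m, w⟩ = 0`
for all `w ∈ τ`. Then for no `η` can one have both `ν_η ∈ τ` and that `⟨·, ν_η⟩` attains
its minimum over `P` at `y`. -/
theorem no_integral_supporting_covector {n : ℕ} {ι : Type*} [Fintype ι]
    (ν : ι → EuclideanSpace ℝ (Fin n))
    (hνint : ∀ η : ι, ∀ i : Fin n, ∃ z : ℤ, ν η i = (z : ℝ))
    (hν0 : ∀ η : ι, ν η ≠ 0)
    (nn : ι → ℝ) (P : Set (EuclideanSpace ℝ (Fin n)))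
    (hP : P = {p : EuclideanSpace ℝ (Fin n) | ∀ η : ι, -(nn η) ≤ ⟪p, ν η⟫})
    (hPne : P.Nonempty)
    (hattain : ∀ η : ι, ∃ p ∈ P, ⟪p, ν η⟫ = -(nn η))
    (hnnint : ∀ η : ι, ¬ ∃ z : ℤ, nn η = (z : ℝ))
    {y : EuclideanSpace ℝ (Fin n)} (hy : y ∈ P)
    (τ : Set (EuclideanSpace ℝ (Fin n)))
    {m : EuclideanSpace ℝ (Fin n)} (hmint : ∀ i : Fin n, ∃ z : ℤ, m i = (z : ℝ))
    (hym : ∀ w ∈ τ, ⟪y - m, w⟫ = 0) :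
    ∀ η : ι, ¬ (ν η ∈ τ ∧ ∀ p ∈ P, 0 ≤ ⟪p - y, ν η⟫) := by
  rintro η ⟨hη, hmin⟩
  obtain ⟨p, hpP, hp⟩ := hattain η
  have hpy := hmin p hpP
  have hmy := hym _ hη
  have hyη : -(nn η) ≤ ⟪y, ν η⟫ := (hP ▸ hy : y ∈ {p | ∀ η, -(nn η) ≤ ⟪p, ν η⟫}) η
  obtain ⟨z, hz⟩ := EuclideanSpace.exists_int_inner_eq hmint (hνint η)
  rw [inner_sub_left] at hpy hmy
  refine hnnint η ⟨-z, ?_⟩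
  push_cast
  linarith
end
end

section
/- Let U ⊆ ℝ^n be an intersection of finitely many closed half-spaces with nonempty interior, and let x be a point of the frontier (topological boundary) of U. Then there exists r₀ > 0 such that for every r with 0 < r ≤ r₀, the set B(x, r) \ U (the open metric ball of radius r around x with U removed) is nonempty and contractible. -/
open scoped RealInnerProductSpace

noncomputable section

/-- A point interior to a closed half-space lies in the corresponding open half-space. -/
theorem inner_lt_of_mem_interior {E : Type*} [NormedAddCommGroup E] [InnerProductSpace ℝ E]
    {S : Set E} {u : E} {b : ℝ} (hu : u ≠ 0) (hS : ∀ y ∈ S, ⟪y, u⟫ ≤ b) {p : E}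
    (hp : p ∈ interior S) : ⟪p, u⟫ < b := by
  have hcont : Filter.Tendsto (fun t : ℝ => p + t • u) (nhdsWithin 0 (Set.Ioi 0)) (nhds p) := by
    have h : Continuous (fun t : ℝ => p + t • u) := by fun_prop
    simpa using (h.tendsto 0).mono_left nhdsWithin_le_nhds
  obtain ⟨t, htS, ht⟩ := ((hcont.eventually (mem_interior_iff_mem_nhds.mp hp)).and
    self_mem_nhdsWithin).exists
  have h := hS _ htS
  rw [inner_add_left, real_inner_smul_left] at h
  have : 0 < t * ⟪u, u⟫ := mul_pos ht (real_inner_self_pos.mpr hu)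
  linarith

/-- Let `U ⊆ ℝⁿ` be an intersection of finitely many closed half-spaces with nonempty
interior, and `x` a point of the frontier of `U`. Then there is `r₀ > 0` such that for
every `0 < r ≤ r₀` the set `B(x, r) \ U` is nonempty and contractible. -/
theorem ball_diff_polyhedron_contractible {n : ℕ} {ι : Type*} [Fintype ι]
    (u : ι → EuclideanSpace ℝ (Fin n)) (hu : ∀ i : ι, u i ≠ 0) (b : ι → ℝ)
    (U : Set (EuclideanSpace ℝ (Fin n)))
    (hU : U = {y | ∀ i : ι, ⟪y, u i⟫ ≤ b i})
    (hint : (interior U).Nonempty)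
    {x : EuclideanSpace ℝ (Fin n)} (hx : x ∈ frontier U) :
    ∃ r₀ : ℝ, 0 < r₀ ∧ ∀ r : ℝ, 0 < r → r ≤ r₀ →
      (Metric.ball x r \ U).Nonempty ∧
        ContractibleSpace (Metric.ball x r \ U : Set (EuclideanSpace ℝ (Fin n))) := by
  have hmem : ∀ y, y ∈ U ↔ ∀ i, ⟪y, u i⟫ ≤ b i := fun y => by rw [hU]; rfl
  have hclosed : IsClosed U := by
    rw [hU, Set.ofPred_forall]
    exact isClosed_iInter fun i => isClosed_le (by fun_prop) continuous_const
  have hxU : ∀ i, ⟪x, u i⟫ ≤ b i := (hmem x).mp (hclosed.frontier_subset hx)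
  have hinactive : ∀ᶠ y in nhds x, ∀ i, ⟪x, u i⟫ < b i → ⟪y, u i⟫ < b i := by
    refine Filter.eventually_all.mpr fun i => ?_
    by_cases hi : ⟪x, u i⟫ < b i
    · have hc : Continuous (fun y => ⟪y, u i⟫) := by fun_prop
      filter_upwards [(hc.tendsto x).eventually_lt_const hi] with y hy _ using hy
    · exact Filter.Eventually.of_forall fun y h => absurd h hi
  obtain ⟨i₀, hi₀⟩ : ∃ i, ⟪x, u i⟫ = b i := by
    by_contra! hne
    refine hx.2 (mem_interior_iff_mem_nhds.mpr ?_)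
    filter_upwards [hinactive] with y hy
    exact (hmem y).mpr fun i => (hy i (lt_of_le_of_ne (hxU i) (hne i))).le
  obtain ⟨p, hp⟩ := hint
  have hpos : ∀ i, ⟪x, u i⟫ = b i → 0 < ⟪x - p, u i⟫ := fun i hi => by
    have := inner_lt_of_mem_interior (hu i) (fun y hy => (hmem y).mp hy i) hp
    rw [inner_sub_left]
    linarith
  obtain ⟨r₀, hr₀, hball⟩ := Metric.eventually_nhds_iff_ball.mp hinactive
  refine ⟨r₀, hr₀, fun r hr hrr₀ => ?_⟩
  have hcont : Filter.Tendsto (fun t : ℝ => x + t • (x - p)) (nhdsWithin 0 (Set.Ioi 0))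
      (nhds x) := by
    have h : Continuous (fun t : ℝ => x + t • (x - p)) := by fun_prop
    simpa using (h.tendsto 0).mono_left nhdsWithin_le_nhds
  obtain ⟨t, htr, ht⟩ := ((hcont.eventually (Metric.ball_mem_nhds x hr)).and
    self_mem_nhdsWithin).exists
  have hcenter : ∀ i, ⟪x, u i⟫ = b i → b i < ⟪x + t • (x - p), u i⟫ := fun i hi => by
    rw [inner_add_left, real_inner_smul_left, hi]
    have : 0 < t * ⟪x - p, u i⟫ := mul_pos ht (hpos i hi)
    linarith
  have hne : (Metric.ball x r \ U).Nonempty :=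
    ⟨x + t • (x - p), htr, fun h => ((hmem _).mp h i₀).not_gt (hcenter i₀ hi₀)⟩
  have hstar : StarConvex ℝ (x + t • (x - p)) (Metric.ball x r \ U) := by
    rintro y ⟨hyr, hyU⟩ α β hα hβ hαβ
    refine ⟨convex_ball x r htr hyr hα hβ hαβ, fun h => ?_⟩
    rw [hmem] at hyU
    push Not at hyU
    obtain ⟨i, hi⟩ := hyU
    have hactive : ⟪x, u i⟫ = b i := by
      by_contra hlt
      exact hi.not_gt (hball y (Metric.ball_subset_ball hrr₀ hyr) i (lt_of_le_of_ne (hxU i) hlt))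
    have hle := (hmem _).mp h i
    rw [inner_add_left, real_inner_smul_left, real_inner_smul_left] at hle
    exact hle.not_gt (convex_Ioi (b i) (hcenter i hactive) hi hα hβ hαβ)
  exact ⟨hne, hstar.contractibleSpace hne⟩
end
end

section
/- Let p: C → D, q: D → E and π₁: E → O be functors between categories, and set π₃ := π₁ ∘ q and π₂ := π₃ ∘ p. Call a morphism f: c → c′ of C F-cocartesian (for a functor F: C → B) if for every morphism g: c → c″ of C and every u: F(c′) → F(c″) with F(g) = u ∘ F(f), there exists a unique v: c′ → c″ with F(v) = u and v ∘ f = g; call F a cocartesian fibration if for every object c of C and every morphism e: F(c) → b of B there exists an F-cocartesian f: c → c′ with F(f) = e. Assume that q, q ∘ p and π₁ are cocartesian fibrations, and that p sends every (q ∘ p)-cocartesian morphism of C to a q-cocartesian morphism of D. Then p sends every π₂-cocartesian morphism of C to a π₃-cocartesian morphism of D. -/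
open CategoryTheory

/-- A morphism `f : c ⟶ c'` is `F`-cocartesian if for every `g : c ⟶ c''` and every
`u : F(c') ⟶ F(c'')` with `F(g) = u ∘ F(f)`, there is a unique `v : c' ⟶ c''` with
`F(v) = u` and `v ∘ f = g`. -/
def IsCocartesianMor {C : Type*} {B : Type*} [Category C] [Category B]
    (F : C ⥤ B) {c c' : C} (f : c ⟶ c') : Prop :=
  ∀ ⦃c'' : C⦄ (g : c ⟶ c'') (u : F.obj c' ⟶ F.obj c''),
    F.map g = F.map f ≫ u → ∃! v : c' ⟶ c'', F.map v = u ∧ f ≫ v = g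

/-- `F` is a cocartesian fibration if every morphism `e : F(c) ⟶ b` admits an
`F`-cocartesian lift `f : c ⟶ c'` with `F(f) = e`. -/
def IsCocartesianFibration {C : Type*} {B : Type*} [Category C] [Category B]
    (F : C ⥤ B) : Prop :=
  ∀ (c : C) ⦃b : B⦄ (e : F.obj c ⟶ b),
    ∃ (c' : C) (f : c ⟶ c'), IsCocartesianMor F f ∧
      ∃ (h : F.obj c' = b), F.map f ≫ eqToHom h = e

namespace IsCocartesianMor

/-- An `F`-cocartesian morphism whose image is `G`-cocartesian is `(F ⋙ G)`-cocartesian. -/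
theorem comp_functor {C D E : Type*} [Category C] [Category D] [Category E]
    {F : C ⥤ D} {G : D ⥤ E} {c c' : C} {f : c ⟶ c'}
    (hf : IsCocartesianMor F f) (hFf : IsCocartesianMor G (F.map f)) :
    IsCocartesianMor (F ⋙ G) f := by
  intro c'' g u hu
  obtain ⟨w, ⟨hwu, hwg⟩, hw⟩ := hFf (F.map g) u hu
  obtain ⟨v, ⟨hvw, hvg⟩, hv⟩ := hf g w hwg.symm
  refine ⟨v, ⟨by rw [Functor.comp_map, hvw, hwu], hvg⟩, ?_⟩
  rintro v' ⟨hv'u, rfl⟩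
  exact hv v' ⟨hw _ ⟨hv'u, (F.map_comp f v').symm⟩, rfl⟩

theorem hom_ext {C B : Type*} [Category C] [Category B] {F : C ⥤ B} {c c' c'' : C}
    {f : c ⟶ c'} (hf : IsCocartesianMor F f) {v w : c' ⟶ c''}
    (hF : F.map v = F.map w) (h : f ≫ v = f ≫ w) : v = w :=
  (hf (f ≫ w) (F.map w) (F.map_comp f w)).unique ⟨hF, h⟩ ⟨rfl, rfl⟩

/-- Cocartesian morphisms with the same source and isomorphic images have isomorphic targets. -/
theorem exists_iso {C B : Type*} [Category C] [Category B] {F : C ⥤ B} {c c₁ c₂ : C}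
    {f : c ⟶ c₁} {g : c ⟶ c₂} (hf : IsCocartesianMor F f) (hg : IsCocartesianMor F g)
    (i : F.obj c₁ ≅ F.obj c₂) (h : F.map f ≫ i.hom = F.map g) :
    ∃ v : c₁ ≅ c₂, f ≫ v.hom = g := by
  obtain ⟨v, ⟨hvi, hvg⟩, -⟩ := hf g i.hom h.symm
  obtain ⟨w, ⟨hwi, hwf⟩, -⟩ := hg f i.inv (by simp [← h])
  exact ⟨⟨v, w, hf.hom_ext (by simp [hvi, hwi]) (by simp [reassoc_of% hvg, hwf]),
    hg.hom_ext (by simp [hvi, hwi]) (by simp [reassoc_of% hwf, hvg])⟩, hvg⟩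

theorem comp_iso {C B : Type*} [Category C] [Category B] {F : C ⥤ B} {c c₁ c₂ : C}
    {f : c ⟶ c₁} (hf : IsCocartesianMor F f) (i : c₁ ≅ c₂) :
    IsCocartesianMor F (f ≫ i.hom) := by
  intro c'' g u hu
  obtain ⟨v, ⟨hvu, hvg⟩, -⟩ := hf g (F.map i.hom ≫ u) (by simpa using hu)
  refine ⟨i.inv ≫ v, ⟨by simp [hvu, ← Functor.map_comp_assoc], by simp [hvg]⟩, ?_⟩
  rintro w ⟨hwu, hwg⟩
  rw [Iso.eq_inv_comp]
  exact hf.hom_ext (by simp [hwu, hvu]) (by rw [hvg, ← hwg, Category.assoc])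

end IsCocartesianMor

/-- Let `p : C ⥤ D`, `q : D ⥤ E`, `π₁ : E ⥤ O`, and set `π₃ := π₁ ∘ q`,
`π₂ := π₃ ∘ p`. If `q`, `q ∘ p` and `π₁` are cocartesian fibrations and `p` sends
`(q ∘ p)`-cocartesian morphisms to `q`-cocartesian morphisms, then `p` sends
`π₂`-cocartesian morphisms to `π₃`-cocartesian morphisms. -/
theorem preserves_cocartesian_over_base
    {C D E O : Type*} [Category C] [Category D] [Category E] [Category O]
    (p : C ⥤ D) (q : D ⥤ E) (π₁ : E ⥤ O)
    (hq : IsCocartesianFibration q)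
    (hqp : IsCocartesianFibration (p ⋙ q))
    (hπ₁ : IsCocartesianFibration π₁)
    (hpres : ∀ {c c' : C} (f : c ⟶ c'),
      IsCocartesianMor (p ⋙ q) f → IsCocartesianMor q (p.map f)) :
    ∀ {c c' : C} (f : c ⟶ c'),
      IsCocartesianMor (p ⋙ (q ⋙ π₁)) f → IsCocartesianMor (q ⋙ π₁) (p.map f) := by
  intro c c' f hf
  obtain ⟨x, e, he, hx, hxe⟩ := hπ₁ ((p ⋙ q).obj c) ((p ⋙ (q ⋙ π₁)).map f)
  obtain ⟨c₁, φ, hφ, rfl, hφe⟩ := hqp c e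
  rw [eqToHom_refl, Category.comp_id] at hφe
  subst hφe
  obtain ⟨i, rfl⟩ := IsCocartesianMor.exists_iso (F := p ⋙ (q ⋙ π₁))
    (hφ.comp_functor he) hf (eqToIso hx) hxe
  rw [p.map_comp]
  exact ((hpres φ hφ).comp_functor he).comp_iso (p.mapIso i)
end
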